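/- Let K be the transition matrix of an irreducible birth and death chain on {0,1,...,n} with stationary distribution π. For 0 ≤ i ≤ n, let L_i be the submatrix of K obtained by removing the row and column indexed by state i. Let λ_1 < ⋯ < λ_n be the non-zero eigenvalues of I − K and λ^{(i)}_1 ≤ ⋯ ≤ λ^{(i)}_n the eigenvalues of I − L_i. Then λ^{(i)}_j ≤ λ_j ≤ λ^{(i)}_{j+1} ≤ λ_{j+1} for all 1 ≤ j < n, and (min{π([0,i]), π([i,n])}/4)·λ_1 ≤ λ^{(i)}_1 ≤ λ_1. In particular, if M is a median of π (i.e. π([0,M]) ≥ 1/2 and π([M,n]) ≥ 1/2), then λ_1/8 ≤ λ^{(M)}_1 ≤ λ_1. -/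

import Mathlib

open scoped BigOperators
open Filter Matrix Polynomial MeasureTheory

noncomputable section

/-- An irreducible birth and death chain on `{0,1,...,n}`, together with its
(unique) stationary distribution. -/
structure BDChain (n : ℕ) where
  K : Matrix (Fin (n + 1)) (Fin (n + 1)) ℝ
  pi : Fin (n + 1) → ℝ
  K_nonneg : ∀ i j, 0 ≤ K i j
  K_rowSum : ∀ i, ∑ j, K i j = 1
  K_tridiag : ∀ i j : Fin (n + 1), 1 < |(i : ℤ) - (j : ℤ)| → K i j = 0
  K_irred : ∀ i : ℕ, ∀ h : i < n,
    0 < K ⟨i, by omega⟩ ⟨i + 1, by omega⟩ ∧ 0 < K ⟨i + 1, by omega⟩ ⟨i, by omega⟩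
  pi_pos : ∀ i, 0 < pi i
  pi_sum : ∑ i, pi i = 1
  pi_stat : ∀ j, ∑ i, pi i * K i j = pi j

namespace BDChain

variable {n : ℕ}

/-- `π([0,M])` -/
def piLow (c : BDChain n) (M : Fin (n + 1)) : ℝ :=
  ∑ ℓ : Fin (n + 1), if ℓ ≤ M then c.pi ℓ else 0

/-- `π([M,n])` -/
def piHigh (c : BDChain n) (M : Fin (n + 1)) : ℝ :=
  ∑ ℓ : Fin (n + 1), if M ≤ ℓ then c.pi ℓ else 0

/-- `π([a,b])` -/
def piInt (c : BDChain n) (a b : Fin (n + 1)) : ℝ :=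
  ∑ ℓ : Fin (n + 1), if a ≤ ℓ ∧ ℓ ≤ b then c.pi ℓ else 0

/-- The substochastic matrix of the chain killed at state `i`. -/
def killed (c : BDChain n) (i : Fin (n + 1)) : Matrix (Fin (n + 1)) (Fin (n + 1)) ℝ :=
  Matrix.of fun x y => if x = i ∨ y = i then 0 else c.K x y

/-- `P_j(τ_i > m)`, where `τ_i` is the discrete-time hitting time of state `i`. -/
def hitSurv (c : BDChain n) (i j : Fin (n + 1)) (m : ℕ) : ℝ :=
  if j = i then 0 else ∑ y, (c.killed i ^ m) j y

/-- `P_j(τ̃_i > t)`, where `τ̃_i` is the continuous-time hitting time of state `i`. -/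
def hitSurvC (c : BDChain n) (i j : Fin (n + 1)) (t : ℝ) : ℝ :=
  ∑' m : ℕ, (Real.exp (-t) * t ^ m / m.factorial) * c.hitSurv i j m

/-- `E_j τ_i` -/
def hitMean (c : BDChain n) (i j : Fin (n + 1)) : ℝ :=
  ∑' m : ℕ, c.hitSurv i j m

/-- `Var_j τ_i` -/
def hitVar (c : BDChain n) (i j : Fin (n + 1)) : ℝ :=
  (∑' m : ℕ, (2 * (m : ℝ) + 1) * c.hitSurv i j m) - (c.hitMean i j) ^ 2

/-- `E_j τ̃_i` -/
def hitMeanC (c : BDChain n) (i j : Fin (n + 1)) : ℝ :=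
  ∫ t in Set.Ioi (0 : ℝ), c.hitSurvC i j t

/-- `Var_j τ̃_i` -/
def hitVarC (c : BDChain n) (i j : Fin (n + 1)) : ℝ :=
  (∫ t in Set.Ioi (0 : ℝ), 2 * t * c.hitSurvC i j t) - (c.hitMeanC i j) ^ 2

/-- The substochastic matrix of the chain killed at states `i` and `k`. -/
def killed2 (c : BDChain n) (i k : Fin (n + 1)) : Matrix (Fin (n + 1)) (Fin (n + 1)) ℝ :=
  Matrix.of fun x y => if x = i ∨ x = k ∨ y = i ∨ y = k then 0 else c.K x y

/-- `P_j(min{τ_i, τ_k} > m)` -/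
def hitSurv2 (c : BDChain n) (i k j : Fin (n + 1)) (m : ℕ) : ℝ :=
  if j = i ∨ j = k then 0 else ∑ y, (c.killed2 i k ^ m) j y

/-- `E_j min{τ_i, τ_k}` -/
def hitMean2 (c : BDChain n) (i k j : Fin (n + 1)) : ℝ :=
  ∑' m : ℕ, c.hitSurv2 i k j m

/-- `E_j min{τ̃_i, τ̃_k}` -/
def hitMean2C (c : BDChain n) (i k j : Fin (n + 1)) : ℝ :=
  ∫ t in Set.Ioi (0 : ℝ),
    ∑' m : ℕ, (Real.exp (-t) * t ^ m / m.factorial) * c.hitSurv2 i k j m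

/-- The continuous-time kernel `H_t(x,y) = e^{-t(I-K)}(x,y)`. -/
def Ht (c : BDChain n) (t : ℝ) (x y : Fin (n + 1)) : ℝ :=
  ∑' m : ℕ, (Real.exp (-t) * t ^ m / m.factorial) * (c.K ^ m) x y

/-- Discrete-time total variation distance from starting state `x` at time `m`. -/
def dTV (c : BDChain n) (x : Fin (n + 1)) (m : ℕ) : ℝ :=
  ⨆ A : Finset (Fin (n + 1)), (∑ y ∈ A, (c.K ^ m) x y - ∑ y ∈ A, c.pi y)

/-- Continuous-time total variation distance from starting state `x` at time `t`. -/
def dTVC (c : BDChain n) (x : Fin (n + 1)) (t : ℝ) : ℝ :=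
  ⨆ A : Finset (Fin (n + 1)), (∑ y ∈ A, c.Ht t x y - ∑ y ∈ A, c.pi y)

/-- Maximum (over starting states) discrete-time total variation distance. -/
def dTVMax (c : BDChain n) (m : ℕ) : ℝ := ⨆ x, c.dTV x m

/-- Maximum (over starting states) continuous-time total variation distance. -/
def dTVMaxC (c : BDChain n) (t : ℝ) : ℝ := ⨆ x, c.dTVC x t

/-- Discrete-time separation from starting state `x` at time `m`. -/
def sep (c : BDChain n) (x : Fin (n + 1)) (m : ℕ) : ℝ :=
  ⨆ y, (1 - (c.K ^ m) x y / c.pi y)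

/-- Continuous-time separation from starting state `x` at time `t`. -/
def sepC (c : BDChain n) (x : Fin (n + 1)) (t : ℝ) : ℝ :=
  ⨆ y, (1 - c.Ht t x y / c.pi y)

end BDChain

/-- Discrete-time `ε`-mixing time for a distance profile `d`. -/
def mixD (d : ℕ → ℝ) (ε : ℝ) : ℕ := sInf {m : ℕ | d m ≤ ε}

/-- Continuous-time `ε`-mixing time for a distance profile `d`. -/
def mixC (d : ℝ → ℝ) (ε : ℝ) : ℝ := sInf {t : ℝ | 0 ≤ t ∧ d t ≤ ε}

/-- The set of (real) eigenvalues of a square matrix. -/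
def eigSet {ι : Type*} [Fintype ι] (M : Matrix ι ι ℝ) : Set ℝ :=
  {x | ∃ v : ι → ℝ, v ≠ 0 ∧ M.mulVec v = x • v}

/-- `l` is the smallest non-zero eigenvalue of `M`. -/
def IsSmallestNonzeroEig {ι : Type*} [Fintype ι] (M : Matrix ι ι ℝ) (l : ℝ) : Prop :=
  l ∈ eigSet M ∧ l ≠ 0 ∧ ∀ x ∈ eigSet M, x ≠ 0 → l ≤ x

/-- `l` is the smallest eigenvalue of `M`. -/
def IsSmallestEig {ι : Type*} [Fintype ι] (M : Matrix ι ι ℝ) (l : ℝ) : Prop :=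
  l ∈ eigSet M ∧ ∀ x ∈ eigSet M, l ≤ x

/-- The principal submatrix of `I - K` indexed by the states `0, 1, ..., M-1`. -/
def BDChain.subIK {n : ℕ} (c : BDChain n) (M : Fin (n + 1)) :
    Matrix (Fin (M : ℕ)) (Fin (M : ℕ)) ℝ :=
  Matrix.of fun a b =>
    (1 - c.K) (Fin.castLE M.isLt.le a) (Fin.castLE M.isLt.le b)

/-- A family of chains, with `ε ↦ n ↦ T ε n` the mixing time profile, presents a cutoff
with cutoff time `t`. -/
def cutoffWith (T : ℝ → ℕ → ℝ) (t : ℕ → ℝ) : Prop :=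
  ∀ ε ∈ Set.Ioo (0 : ℝ) 1, Filter.Tendsto (fun n => T ε n / t n) Filter.atTop (nhds 1)

/-- A family of chains presents a cutoff. -/
def hasCutoff (T : ℝ → ℕ → ℝ) : Prop :=
  ∃ t : ℕ → ℝ, (∀ n, 0 < t n) ∧ cutoffWith T t

/-- A family of chains presents a `(t_n, b_n)` cutoff. -/
def cutoffWindow (T : ℝ → ℕ → ℝ) (t b : ℕ → ℝ) : Prop :=
  (∀ᶠ n in Filter.atTop, 0 < t n) ∧ (∀ᶠ n in Filter.atTop, 0 < b n) ∧
  Filter.Tendsto (fun n => b n / t n) Filter.atTop (nhds 0) ∧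
  ∀ ε ∈ Set.Ioo (0 : ℝ) 1, ∃ C : ℝ, ∀ᶠ n in Filter.atTop, |T ε n - t n| ≤ C * b n


/-- Two finite families with the same multiset of values differ by a reindexing. -/
lemma exists_equiv_of_map_univ_eq {α β γ : Type*} [Fintype α] [Fintype β]
    (f : α → γ) (g : β → γ)
    (h : Multiset.map f Finset.univ.val = Multiset.map g Finset.univ.val) :
    ∃ e : α ≃ β, ∀ x, g (e x) = f x := by
  classical
  have hc : ∀ c, Nonempty ({a // f a = c} ≃ {b // g b = c}) := by
    intro c
    have h1 := congrArg (Multiset.count c) h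
    rw [Multiset.count_map, Multiset.count_map] at h1
    refine ⟨Fintype.equivOfCardEq ?_⟩
    rw [Fintype.card_subtype, Fintype.card_subtype]
    simpa [Finset.card_def, Finset.filter_val, eq_comm] using h1
  exact ⟨Equiv.ofFiberEquiv fun c => (hc c).some, fun x => Equiv.ofFiberEquiv_map _ x⟩

/-- Spectral resolution of the quadratic form of a real symmetric matrix, indexed by a given
enumeration of the roots of its characteristic polynomial. -/
lemma exists_spectral_resolution {ι : Type*} [Fintype ι] [DecidableEq ι] {N : ℕ}
    {A : Matrix ι ι ℝ} (hA : A.IsHermitian) {a : Fin N → ℝ}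
    (h : A.charpoly = ∏ j, (Polynomial.X - Polynomial.C (a j))) :
    ∃ u : Fin N → ι → ℝ, (∀ x, x ⬝ᵥ x = ∑ j, (u j ⬝ᵥ x) ^ 2) ∧
      ∀ x, x ⬝ᵥ (A *ᵥ x) = ∑ j, a j * (u j ⬝ᵥ x) ^ 2 := by
  have h1 := hA.roots_charpoly_eq_eigenvalues
  have h2 : A.charpoly.roots = Multiset.map a Finset.univ.val := by
    rw [h, Polynomial.roots_prod]
    · simp
    · simp [Finset.prod_ne_zero_iff, Polynomial.X_sub_C_ne_zero]
  obtain ⟨e, he⟩ := exists_equiv_of_map_univ_eq _ _ (h2.symm.trans h1)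
  set b := hA.eigenvectorBasis
  have key : ∀ x z : ι → ℝ, x ⬝ᵥ z = ∑ j, (b j ⬝ᵥ x) * (b j ⬝ᵥ z) := by
    intro x z
    have := b.sum_inner_mul_inner (WithLp.toLp 2 x) (WithLp.toLp 2 z)
    simp only [EuclideanSpace.inner_eq_star_dotProduct, star_trivial] at this
    rw [dotProduct_comm x z, ← this]
    refine Finset.sum_congr rfl fun j _ => ?_
    rw [dotProduct_comm z]
  refine ⟨fun j => b (e j), fun x => ?_, fun x => ?_⟩
  · rw [key x x, ← e.sum_comp]
    exact Finset.sum_congr rfl fun j _ => by ring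
  · rw [key x _, ← e.sum_comp]
    refine Finset.sum_congr rfl fun j _ => ?_
    have h3 : b (e j) ⬝ᵥ (A *ᵥ x) = a j * (b (e j) ⬝ᵥ x) := by
      have hT : Aᵀ = A := by simpa [Matrix.IsSymm] using hA
      have h4 := hA.mulVec_eigenvectorBasis (e j)
      have h5 : hA.eigenvalues (e j) = a j := by simpa using he j
      rw [dotProduct_mulVec, ← mulVec_transpose, hT, h4, h5, smul_dotProduct, smul_eq_mul]
    rw [h3]; ring

lemma exists_ne_zero_of_card_lt {ι κ : Type*} [Fintype ι] [Fintype κ]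
    (φ : κ → (ι → ℝ) →ₗ[ℝ] ℝ) (h : Fintype.card κ < Fintype.card ι) :
    ∃ v ≠ 0, ∀ k, φ k v = 0 := by
  have := LinearMap.ker_ne_bot_of_finrank_lt (f := LinearMap.pi φ) (by simpa using h)
  obtain ⟨v, hv, hne⟩ := (Submodule.ne_bot_iff _).1 this
  exact ⟨v, hne, fun k => congrFun (LinearMap.mem_ker.1 hv) k⟩

lemma dotProduct_self_pos {ι : Type*} [Fintype ι] {v : ι → ℝ} (h : v ≠ 0) : 0 < v ⬝ᵥ v := by
  simpa using Matrix.dotProduct_star_self_pos_iff.2 h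

lemma extend_dotProduct {ι κ : Type*} [Fintype ι] [Fintype κ] {e : κ → ι}
    (he : Function.Injective e) (y : κ → ℝ) (z : ι → ℝ) :
    Function.extend e y 0 ⬝ᵥ z = y ⬝ᵥ (z ∘ e) := by
  refine (Fintype.sum_of_injective e he _ _ (fun x hx => ?_) fun k => ?_).symm
  · rw [Function.extend_apply' _ _ _ (by simpa using hx)]; simp
  · simp [he.extend_apply]

lemma extend_dotProduct_self {ι κ : Type*} [Fintype ι] [Fintype κ] {e : κ → ι}
    (he : Function.Injective e) (y : κ → ℝ) :
    Function.extend e y 0 ⬝ᵥ Function.extend e y 0 = y ⬝ᵥ y := by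
  rw [extend_dotProduct he, Function.extend_comp he]

lemma extend_dotProduct_mulVec {ι κ : Type*} [Fintype ι] [Fintype κ] {e : κ → ι}
    (he : Function.Injective e) (A : Matrix ι ι ℝ) (y : κ → ℝ) :
    Function.extend e y 0 ⬝ᵥ (A *ᵥ Function.extend e y 0) = y ⬝ᵥ (A.submatrix e e *ᵥ y) := by
  rw [extend_dotProduct he]
  congr 1
  ext k
  simp only [Function.comp_apply, mulVec]
  rw [dotProduct_comm, extend_dotProduct he, dotProduct_comm]
  rfl

/-- **Cauchy interlacing** for a principal submatrix of codimension one. -/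
lemma cauchy_interlacing {ι κ : Type*} [Fintype ι] [Fintype κ] [DecidableEq ι] [DecidableEq κ]
    {n : ℕ} (hκ : Fintype.card κ = n) {A : Matrix ι ι ℝ} (hA : A.IsHermitian)
    {e : κ → ι} (he : Function.Injective e) {a : Fin (n + 1) → ℝ} {b : Fin n → ℝ}
    (ha : Monotone a) (hb : Monotone b)
    (hAa : A.charpoly = ∏ j, (Polynomial.X - Polynomial.C (a j)))
    (hBb : (A.submatrix e e).charpoly = ∏ j, (Polynomial.X - Polynomial.C (b j)))
    (j : Fin n) : a j.castSucc ≤ b j ∧ b j ≤ a j.succ := by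
  obtain ⟨u, hu1, hu2⟩ := exists_spectral_resolution hA hAa
  obtain ⟨w, hw1, hw2⟩ := exists_spectral_resolution (hA.submatrix e) hBb
  have exists_test : ∀ (P : Finset (Fin n)) (Q : Finset (Fin (n + 1))), P.card + Q.card < n →
      ∃ y : κ → ℝ, y ≠ 0 ∧ (∀ l ∈ P, w l ⬝ᵥ y = 0) ∧
        ∀ l ∈ Q, u l ⬝ᵥ Function.extend e y 0 = 0 := by
    intro P Q hPQ
    obtain ⟨y, hy, h⟩ := exists_ne_zero_of_card_lt (κ := P ⊕ Q)
      (Sum.elim (fun l => dotProductBilin ℝ ℝ (w l))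
        (fun l => dotProductBilin ℝ ℝ (u l ∘ e))) (by simpa [hκ] using hPQ)
    refine ⟨y, hy, fun l hl => h (Sum.inl ⟨l, hl⟩), fun l hl => ?_⟩
    rw [dotProduct_comm, extend_dotProduct he, dotProduct_comm]
    exact h (Sum.inr ⟨l, hl⟩)
  constructor
  · obtain ⟨y, hy, hP, hQ⟩ := exists_test (Finset.Ioi j) (Finset.Iio j.castSucc)
      (by have := j.2; simp; omega)
    refine le_of_mul_le_mul_right ?_ (dotProduct_self_pos hy)
    calc a j.castSucc * (y ⬝ᵥ y)
        ≤ Function.extend e y 0 ⬝ᵥ (A *ᵥ Function.extend e y 0) := by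
          rw [← extend_dotProduct_self he, hu1, hu2, Finset.mul_sum]
          refine Finset.sum_le_sum fun l _ => ?_
          rcases lt_or_ge l j.castSucc with hl | hl
          · simp [hQ l (by simpa using hl)]
          · exact mul_le_mul_of_nonneg_right (ha hl) (sq_nonneg _)
      _ ≤ b j * (y ⬝ᵥ y) := by
          rw [extend_dotProduct_mulVec he, hw1, hw2, Finset.mul_sum]
          refine Finset.sum_le_sum fun l _ => ?_
          rcases lt_or_ge j l with hl | hl
          · simp [hP l (by simpa using hl)]
          · exact mul_le_mul_of_nonneg_right (hb hl) (sq_nonneg _)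
  · obtain ⟨y, hy, hP, hQ⟩ := exists_test (Finset.Iio j) (Finset.Ioi j.succ)
      (by have := j.2; simp; omega)
    refine le_of_mul_le_mul_right ?_ (dotProduct_self_pos hy)
    calc b j * (y ⬝ᵥ y)
        ≤ Function.extend e y 0 ⬝ᵥ (A *ᵥ Function.extend e y 0) := by
          rw [extend_dotProduct_mulVec he, hw1, hw2, Finset.mul_sum]
          refine Finset.sum_le_sum fun l _ => ?_
          rcases lt_or_ge l j with hl | hl
          · simp [hP l (by simpa using hl)]
          · exact mul_le_mul_of_nonneg_right (hb hl) (sq_nonneg _)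
      _ ≤ a j.succ * (y ⬝ᵥ y) := by
          rw [← extend_dotProduct_self he, hu1, hu2, Finset.mul_sum]
          refine Finset.sum_le_sum fun l _ => ?_
          rcases lt_or_ge j.succ l with hl | hl
          · simp [hQ l (by simpa using hl)]
          · exact mul_le_mul_of_nonneg_right (ha hl) (sq_nonneg _)

/-- The quadratic form of a symmetric matrix attains each eigenvalue as a Rayleigh quotient. -/
lemma exists_ne_zero_dotProduct_mulVec_eq {ι : Type*} [Fintype ι] [DecidableEq ι] {n : ℕ}
    (hn : 0 < n) (hι : Fintype.card ι = n) {A : Matrix ι ι ℝ} (hA : A.IsHermitian)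
    {a : Fin n → ℝ} (hAa : A.charpoly = ∏ j, (Polynomial.X - Polynomial.C (a j)))
    (j : Fin n) : ∃ y ≠ 0, y ⬝ᵥ (A *ᵥ y) = a j * (y ⬝ᵥ y) := by
  obtain ⟨u, hu1, hu2⟩ := exists_spectral_resolution hA hAa
  obtain ⟨y, hy, h⟩ := exists_ne_zero_of_card_lt (κ := {l : Fin n // l ≠ j})
    (fun l => dotProductBilin ℝ ℝ (u l)) (by simp [hι]; omega)
  refine ⟨y, hy, ?_⟩
  rw [hu1, hu2, Finset.mul_sum]
  refine Finset.sum_congr rfl fun l _ => ?_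
  rcases eq_or_ne l j with rfl | hl
  · rfl
  · have : u l ⬝ᵥ y = 0 := h ⟨l, hl⟩
    simp [this]

/-- Poincaré inequality for a positive semidefinite matrix with one-dimensional kernel. -/
lemma poincare_of_charpoly {ι : Type*} [Fintype ι] [DecidableEq ι] {n : ℕ} (hn : 0 < n)
    {S : Matrix ι ι ℝ} (hS : S.IsHermitian) {a : Fin n → ℝ} (ha : Monotone a)
    (ha0 : 0 < a ⟨0, hn⟩)
    (hSa : S.charpoly = Polynomial.X * ∏ j, (Polynomial.X - Polynomial.C (a j)))
    {s : ι → ℝ} (hs : s ⬝ᵥ s = 1) (hSs : S *ᵥ s = 0) (x : ι → ℝ) :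
    a ⟨0, hn⟩ * (x ⬝ᵥ x - (x ⬝ᵥ s) ^ 2) ≤ x ⬝ᵥ (S *ᵥ x) := by
  have hle : ∀ j, a ⟨0, hn⟩ ≤ a j := fun j => ha (Nat.zero_le _)
  obtain ⟨u, hu1, hu2⟩ := exists_spectral_resolution hS
    (a := (Fin.cons 0 a : Fin (n + 1) → ℝ)) (by rw [hSa, Fin.prod_univ_succ]; simp)
  simp only [Fin.sum_univ_succ, Fin.cons_zero, Fin.cons_succ, zero_mul, zero_add] at hu1 hu2
  have hus : ∀ j : Fin n, (u j.succ ⬝ᵥ s) ^ 2 = 0 := by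
    have h0 := hu2 s
    rw [hSs, dotProduct_zero] at h0
    intro j
    have := (Finset.sum_eq_zero_iff_of_nonneg fun l _ =>
      mul_nonneg (ha0.le.trans (hle l)) (sq_nonneg _)).1 h0.symm j (Finset.mem_univ j)
    exact (mul_eq_zero.1 this).resolve_left (ha0.trans_le (hle j)).ne'
  have hu0 : u 0 ⬝ᵥ s ≠ 0 := by
    intro h
    have := hu1 s
    simp [hs, hus, h] at this
  set t := (u 0 ⬝ᵥ x) / (u 0 ⬝ᵥ s) with ht
  have hy0 : u 0 ⬝ᵥ (x - t • s) = 0 := by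
    rw [dotProduct_sub, dotProduct_smul, ht, smul_eq_mul, div_mul_cancel₀ _ hu0, sub_self]
  have hyS : (x - t • s) ⬝ᵥ (S *ᵥ (x - t • s)) = x ⬝ᵥ (S *ᵥ x) := by
    have hT : Sᵀ = S := by simpa [Matrix.IsSymm] using hS
    have h1 : s ⬝ᵥ (S *ᵥ x) = 0 := by
      rw [dotProduct_mulVec, ← mulVec_transpose, hT, hSs, zero_dotProduct]
    rw [mulVec_sub, mulVec_smul, hSs, smul_zero, sub_zero, sub_dotProduct, smul_dotProduct, h1,
      smul_zero, sub_zero]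
  have hyy : (x - t • s) ⬝ᵥ (x - t • s) = x ⬝ᵥ x - 2 * t * (x ⬝ᵥ s) + t ^ 2 := by
    simp only [sub_dotProduct, dotProduct_sub, smul_dotProduct, dotProduct_smul, smul_eq_mul, hs,
      dotProduct_comm s x]
    ring
  calc a ⟨0, hn⟩ * (x ⬝ᵥ x - (x ⬝ᵥ s) ^ 2)
      ≤ a ⟨0, hn⟩ * ((x - t • s) ⬝ᵥ (x - t • s)) := by
        refine mul_le_mul_of_nonneg_left ?_ ha0.le
        rw [hyy]; nlinarith [sq_nonneg (t - x ⬝ᵥ s)]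
    _ ≤ (x - t • s) ⬝ᵥ (S *ᵥ (x - t • s)) := by
        rw [hu1, hu2, hy0, zero_pow two_ne_zero, zero_add, Finset.mul_sum]
        exact Finset.sum_le_sum fun l _ => mul_le_mul_of_nonneg_right (hle l) (sq_nonneg _)
    _ = _ := hyS

lemma charpoly_diagonal_conj {ι : Type*} [Fintype ι] [DecidableEq ι] (A : Matrix ι ι ℝ)
    {s : ι → ℝ} (hs : ∀ x, s x ≠ 0) :
    (Matrix.of fun x y => s x * A x y / s y).charpoly = A.charpoly := by
  have : (Matrix.of fun x y => s x * A x y / s y) =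
      diagonal s * (A * diagonal fun y => (s y)⁻¹) := by
    ext x y
    simp [diagonal_mul, mul_diagonal, div_eq_mul_inv, mul_assoc]
  rw [this, Matrix.charpoly_mul_comm, Matrix.mul_assoc, diagonal_mul_diagonal]
  simp [hs]

namespace BDChain

variable {n : ℕ}

/-- A birth and death chain is reversible with respect to its stationary distribution. -/
lemma detailed_balance (c : BDChain n) (x y : Fin (n + 1)) :
    c.pi x * c.K x y = c.pi y * c.K y x := by
  have hsum : ∀ x, ∑ y, (c.pi x * c.K x y - c.pi y * c.K y x) = 0 := by
    intro x
    rw [Finset.sum_sub_distrib, ← Finset.mul_sum, c.K_rowSum, c.pi_stat, mul_one, sub_self]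
  have main : ∀ m : ℕ, ∀ x y : Fin (n + 1), (x : ℕ) = m → x < y →
      c.pi x * c.K x y = c.pi y * c.K y x := by
    intro m
    induction m using Nat.strong_induction_on with
    | _ m ih =>
      intro x y hx hxy
      by_cases hy : (y : ℕ) = x + 1
      · have h := hsum x
        rw [Finset.sum_eq_single y] at h
        · linarith
        · intro z _ hz
          rcases lt_trichotomy z x with hzx | rfl | hzx
          · linarith [ih z (by omega) z x rfl hzx]
          · ring
          · have h1 : 1 < |((z : ℕ) : ℤ) - ((x : ℕ) : ℤ)| := by
              rw [lt_abs]; left; omega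
            rw [c.K_tridiag z x h1, c.K_tridiag x z (by rwa [abs_sub_comm])]
            ring
        · simp
      · have h1 : 1 < |((y : ℕ) : ℤ) - ((x : ℕ) : ℤ)| := by
          rw [lt_abs]; left; omega
        rw [c.K_tridiag y x h1, c.K_tridiag x y (by rwa [abs_sub_comm])]
        ring
  rcases lt_trichotomy x y with h | rfl | h
  · exact main _ x y rfl h
  · rfl
  · exact (main _ y x rfl h).symm

/-- The symmetrization `D^{1/2} (I - K) D^{-1/2}`, where `D` is the diagonal matrix of `π`. -/
def symm (c : BDChain n) : Matrix (Fin (n + 1)) (Fin (n + 1)) ℝ :=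
  Matrix.of fun x y => √(c.pi x) * (1 - c.K) x y / √(c.pi y)

lemma sqrt_pi_pos (c : BDChain n) (x : Fin (n + 1)) : 0 < √(c.pi x) :=
  Real.sqrt_pos.2 (c.pi_pos x)

lemma symm_isHermitian (c : BDChain n) : c.symm.IsHermitian := by
  refine Matrix.IsHermitian.ext fun x y => ?_
  have hb : c.pi x * (1 - c.K) x y = c.pi y * (1 - c.K) y x := by
    have := c.detailed_balance x y
    rcases eq_or_ne x y with rfl | h
    · rfl
    · simp only [Matrix.sub_apply, Matrix.one_apply_ne h, Matrix.one_apply_ne h.symm]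
      linarith
  simp only [symm, Matrix.of_apply, star_trivial]
  rw [div_eq_div_iff (c.sqrt_pi_pos x).ne' (c.sqrt_pi_pos y).ne']
  have hx := Real.mul_self_sqrt (c.pi_pos x).le
  have hy := Real.mul_self_sqrt (c.pi_pos y).le
  linear_combination (-1) * hb + (1 - c.K) y x * hy - (1 - c.K) x y * hx

lemma symm_mulVec_sqrt_pi (c : BDChain n) : c.symm *ᵥ (fun x => √(c.pi x)) = 0 := by
  ext x
  have : ∀ y, √(c.pi x) * (1 - c.K) x y / √(c.pi y) * √(c.pi y) =
      √(c.pi x) * (1 - c.K) x y := fun y => div_mul_cancel₀ _ (c.sqrt_pi_pos y).ne'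
  simp only [mulVec, dotProduct, symm, Matrix.of_apply, this, ← Finset.mul_sum]
  simp [Matrix.one_apply, c.K_rowSum]

lemma symm_eq_zero (c : BDChain n) {x i y : Fin (n + 1)} (hx : x < i) (hy : i < y) :
    c.symm x y = 0 := by
  have h1 : 1 < |((x : ℕ) : ℤ) - ((y : ℕ) : ℤ)| := by
    rw [lt_abs]; right; omega
  simp [symm, Matrix.one_apply_ne (hx.trans hy).ne, c.K_tridiag x y h1]

lemma sqrt_pi_dotProduct_self (c : BDChain n) :
    (fun x => √(c.pi x)) ⬝ᵥ (fun x => √(c.pi x)) = 1 := by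
  simp only [dotProduct, Real.mul_self_sqrt (c.pi_pos _).le, c.pi_sum]

/-- The eigenvalues of `I - K` are nonnegative. -/
lemma nonneg_of_isRoot (c : BDChain n) {r : ℝ} (h : (1 - c.K).charpoly.IsRoot r) : 0 ≤ r := by
  have hev : Module.End.HasEigenvalue (Matrix.toLin' (1 - c.K)) r := by
    rwa [Module.End.hasEigenvalue_iff_isRoot_charpoly, Matrix.charpoly_toLin']
  obtain ⟨k, hk⟩ := eigenvalue_mem_ball hev
  rw [Metric.mem_closedBall, Real.dist_eq] at hk
  have h1 : ∑ j ∈ Finset.univ.erase k, ‖(1 - c.K) k j‖ = 1 - c.K k k := by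
    rw [← c.K_rowSum k, ← Finset.add_sum_erase _ _ (Finset.mem_univ k), add_sub_cancel_left]
    refine Finset.sum_congr rfl fun j hj => ?_
    rw [Matrix.sub_apply, Matrix.one_apply_ne (Finset.ne_of_mem_erase hj).symm, zero_sub,
      norm_neg, Real.norm_of_nonneg (c.K_nonneg k j)]
  rw [h1, Matrix.sub_apply, Matrix.one_apply_eq] at hk
  linarith [(abs_le.1 hk).1]

/-- Cauchy–Schwarz for a vector supported in a set of states. -/
lemma sq_dotProduct_sqrt_pi_le (c : BDChain n) (P : Fin (n + 1) → Prop) [DecidablePred P]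
    {x : Fin (n + 1) → ℝ} (hx : ∀ k, ¬ P k → x k = 0) :
    (x ⬝ᵥ fun k => √(c.pi k)) ^ 2 ≤ (x ⬝ᵥ x) * ∑ k, if P k then c.pi k else 0 := by
  have h : (x ⬝ᵥ fun k => √(c.pi k)) = ∑ k, x k * if P k then √(c.pi k) else 0 := by
    refine Finset.sum_congr rfl fun k _ => ?_
    by_cases hk : P k
    · simp [hk]
    · simp [hk, hx k hk]
  rw [h]
  refine (Finset.sum_mul_sq_le_sq_mul_sq _ _ _).trans_eq ?_
  congr 1
  · exact Finset.sum_congr rfl fun k _ => sq (x k)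
  · refine Finset.sum_congr rfl fun k _ => ?_
    split_ifs
    · exact Real.sq_sqrt (c.pi_pos k).le
    · simp

lemma piLow_nonneg (c : BDChain n) (i : Fin (n + 1)) : 0 ≤ c.piLow i :=
  Finset.sum_nonneg fun k _ => by split_ifs <;> simp [(c.pi_pos k).le]

lemma piHigh_nonneg (c : BDChain n) (i : Fin (n + 1)) : 0 ≤ c.piHigh i :=
  Finset.sum_nonneg fun k _ => by split_ifs <;> simp [(c.pi_pos k).le]

lemma sum_lt_add_piHigh (c : BDChain n) (i : Fin (n + 1)) :
    (∑ k, if k < i then c.pi k else 0) + c.piHigh i = 1 := by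
  rw [← c.pi_sum, piHigh, ← Finset.sum_add_distrib]
  refine Finset.sum_congr rfl fun k _ => ?_
  by_cases h : k < i
  · simp [h, not_le.2 h]
  · simp [h, not_lt.1 h]

lemma sum_gt_add_piLow (c : BDChain n) (i : Fin (n + 1)) :
    (∑ k, if i < k then c.pi k else 0) + c.piLow i = 1 := by
  rw [← c.pi_sum, piLow, ← Finset.sum_add_distrib]
  refine Finset.sum_congr rfl fun k _ => ?_
  by_cases h : i < k
  · simp [h, not_le.2 h]
  · simp [h, not_lt.1 h]

/-- Dirichlet spectral gap bound: a Poincaré inequality improves on vectors vanishing at `i`. -/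
lemma min_mul_le_of_eq_zero (c : BDChain n) (i : Fin (n + 1)) {l : ℝ} (hl : 0 ≤ l)
    (hP : ∀ x, l * (x ⬝ᵥ x - (x ⬝ᵥ fun k => √(c.pi k)) ^ 2) ≤ x ⬝ᵥ (c.symm *ᵥ x))
    {x : Fin (n + 1) → ℝ} (hx : x i = 0) :
    min (c.piLow i) (c.piHigh i) * l * (x ⬝ᵥ x) ≤ x ⬝ᵥ (c.symm *ᵥ x) := by
  set y : Fin (n + 1) → ℝ := fun k => if k < i then x k else 0 with hy
  set z : Fin (n + 1) → ℝ := fun k => if i < k then x k else 0 with hz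
  have hxyz : x = y + z := by
    ext k
    rcases lt_trichotomy k i with h | rfl | h
    · simp [hy, hz, h, h.le]
    · simp [hy, hz, hx]
    · simp [hy, hz, h, h.le]
  have hT : c.symmᵀ = c.symm := by simpa [Matrix.IsSymm] using c.symm_isHermitian
  have hcross : y ⬝ᵥ (c.symm *ᵥ z) = 0 := by
    refine Finset.sum_eq_zero fun a _ => ?_
    by_cases ha : a < i
    · have : (c.symm *ᵥ z) a = 0 := by
        rw [mulVec, dotProduct]
        refine Finset.sum_eq_zero fun b _ => ?_
        by_cases hb : i < b
        · simp [c.symm_eq_zero ha hb]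
        · simp [hz, hb]
      rw [this, mul_zero]
    · simp [hy, ha]
  have hcross' : z ⬝ᵥ (c.symm *ᵥ y) = 0 := by
    rw [dotProduct_mulVec, ← mulVec_transpose, hT, dotProduct_comm, hcross]
  have hyz : y ⬝ᵥ z = 0 := by
    refine Finset.sum_eq_zero fun a _ => ?_
    by_cases ha : a < i
    · simp [hz, not_lt.2 ha.le]
    · simp [hy, ha]
  have hxx : x ⬝ᵥ x = y ⬝ᵥ y + z ⬝ᵥ z := by
    rw [hxyz, add_dotProduct, dotProduct_add, dotProduct_add, dotProduct_comm z y, hyz,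
      add_zero, zero_add]
  have hxSx : x ⬝ᵥ (c.symm *ᵥ x) = y ⬝ᵥ (c.symm *ᵥ y) + z ⬝ᵥ (c.symm *ᵥ z) := by
    rw [hxyz, mulVec_add, add_dotProduct, dotProduct_add, dotProduct_add, hcross, hcross']
    ring
  have hyb := c.sq_dotProduct_sqrt_pi_le (fun k => k < i) (x := y) (fun k hk => by simp [hy, hk])
  have hzb := c.sq_dotProduct_sqrt_pi_le (fun k => i < k) (x := z) (fun k hk => by simp [hz, hk])
  rw [eq_sub_of_add_eq (c.sum_lt_add_piHigh i)] at hyb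
  rw [eq_sub_of_add_eq (c.sum_gt_add_piLow i)] at hzb
  have hyy : 0 ≤ y ⬝ᵥ y := Finset.sum_nonneg fun k _ => mul_self_nonneg _
  have hzz : 0 ≤ z ⬝ᵥ z := Finset.sum_nonneg fun k _ => mul_self_nonneg _
  calc min (c.piLow i) (c.piHigh i) * l * (x ⬝ᵥ x)
      = l * (min (c.piLow i) (c.piHigh i) * (y ⬝ᵥ y))
        + l * (min (c.piLow i) (c.piHigh i) * (z ⬝ᵥ z)) := by rw [hxx]; ring
    _ ≤ l * (c.piHigh i * (y ⬝ᵥ y)) + l * (c.piLow i * (z ⬝ᵥ z)) := by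
        gcongr
        · exact min_le_right _ _
        · exact min_le_left _ _
    _ ≤ l * (y ⬝ᵥ y - (y ⬝ᵥ fun k => √(c.pi k)) ^ 2)
        + l * (z ⬝ᵥ z - (z ⬝ᵥ fun k => √(c.pi k)) ^ 2) := by
        gcongr <;> linarith
    _ ≤ _ := by rw [hxSx]; exact add_le_add (hP y) (hP z)

end BDChain

/-- Lemma `l-gap`.  Interlacing of the eigenvalues `λ^{(i)}_1 ≤ … ≤ λ^{(i)}_n`
of `I − L_i` (where `L_i` deletes row and column `i` of `K`) with the non-zero eigenvalues
`λ_1 < … < λ_n` of `I − K`, together with `(min{π([0,i]),π([i,n])}/4)·λ_1 ≤ λ^{(i)}_1 ≤ λ_1`;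
in particular `λ_1/8 ≤ λ^{(M)}_1 ≤ λ_1` when `i = M` is a median of `π`. -/
theorem birth_death_deleted_state_eigenvalue_interlacing
    {n : ℕ} (hn : 0 < n) (c : BDChain n) (i : Fin (n + 1))
    (lam lam' : Fin n → ℝ)
    (hlam_mono : StrictMono lam) (hlam'_mono : Monotone lam')
    (hlam : Matrix.charpoly (1 - c.K) =
      Polynomial.X * ∏ j, (Polynomial.X - Polynomial.C (lam j)))
    (hlam_ne : ∀ j, lam j ≠ 0)
    (hlam' : Matrix.charpoly
        ((1 : Matrix {y : Fin (n + 1) // y ≠ i} {y : Fin (n + 1) // y ≠ i} ℝ) -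
          Matrix.of (fun a b => c.K a.1 b.1)) =
      ∏ j, (Polynomial.X - Polynomial.C (lam' j))) :
    (∀ j : ℕ, ∀ hj : j + 1 < n,
      lam' ⟨j, by omega⟩ ≤ lam ⟨j, by omega⟩ ∧
      lam ⟨j, by omega⟩ ≤ lam' ⟨j + 1, hj⟩ ∧
      lam' ⟨j + 1, hj⟩ ≤ lam ⟨j + 1, hj⟩) ∧
    (min (c.piLow i) (c.piHigh i) / 4) * lam ⟨0, hn⟩ ≤ lam' ⟨0, hn⟩ ∧
    lam' ⟨0, hn⟩ ≤ lam ⟨0, hn⟩ ∧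
    ((1 / 2 ≤ c.piLow i ∧ 1 / 2 ≤ c.piHigh i) →
      lam ⟨0, hn⟩ / 8 ≤ lam' ⟨0, hn⟩ ∧ lam' ⟨0, hn⟩ ≤ lam ⟨0, hn⟩) := by
  have hcard : Fintype.card {y : Fin (n + 1) // y ≠ i} = n := by simp
  have hinj : Function.Injective (Subtype.val : {y : Fin (n + 1) // y ≠ i} → Fin (n + 1)) :=
    Subtype.val_injective
  have hS : c.symm.charpoly =
      Polynomial.X * ∏ j, (Polynomial.X - Polynomial.C (lam j)) := by
    rw [← hlam]
    exact charpoly_diagonal_conj _ fun x => (c.sqrt_pi_pos x).ne'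
  have hsub : (c.symm.submatrix Subtype.val Subtype.val :
      Matrix {y : Fin (n + 1) // y ≠ i} {y : Fin (n + 1) // y ≠ i} ℝ).charpoly =
      ∏ j, (Polynomial.X - Polynomial.C (lam' j)) := by
    rw [← hlam']
    refine Eq.trans ?_ (charpoly_diagonal_conj _ (s := fun x : {y : Fin (n + 1) // y ≠ i} =>
      √(c.pi x)) fun x => (c.sqrt_pi_pos x).ne')
    congr 1
    ext a b
    simp [BDChain.symm, Matrix.one_apply, Subtype.ext_iff]
  have hpos : ∀ j, 0 < lam j := fun j =>
    lt_of_le_of_ne (c.nonneg_of_isRoot (by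
      rw [hlam, Polynomial.IsRoot, Polynomial.eval_mul, Polynomial.eval_prod,
        Finset.prod_eq_zero (Finset.mem_univ j) (by simp), mul_zero])) (hlam_ne j).symm
  have hcons : Monotone (Fin.cons 0 lam : Fin (n + 1) → ℝ) := by
    refine Fin.monotone_iff_le_succ.2 fun j => ?_
    rw [Fin.cons_succ]
    refine Fin.cases ?_ (fun k => ?_) j.castSucc
      (motive := fun k => k < j.succ → (Fin.cons 0 lam : Fin (n + 1) → ℝ) k ≤ lam j)
      Fin.castSucc_lt_succ
    · exact fun _ => (hpos j).le
    · exact fun hk => hlam_mono.monotone (Fin.succ_lt_succ_iff.1 hk).le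
  have hint := cauchy_interlacing hcard c.symm_isHermitian hinj hcons hlam'_mono
    (by rw [hS, Fin.prod_univ_succ]; simp) hsub
  have hupper : ∀ j, lam' j ≤ lam j := fun j => by simpa using (hint j).2
  have hlower : min (c.piLow i) (c.piHigh i) * lam ⟨0, hn⟩ ≤ lam' ⟨0, hn⟩ := by
    obtain ⟨y, hy, hyB⟩ := exists_ne_zero_dotProduct_mulVec_eq hn hcard
      (c.symm_isHermitian.submatrix Subtype.val) hsub ⟨0, hn⟩
    have h := c.min_mul_le_of_eq_zero i (hpos ⟨0, hn⟩).le
      (poincare_of_charpoly hn c.symm_isHermitian hlam_mono.monotone (hpos _) hS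
        c.sqrt_pi_dotProduct_self c.symm_mulVec_sqrt_pi)
      (x := Function.extend Subtype.val y 0)
      (Function.extend_apply' _ _ _ (by rintro ⟨a, ha⟩; exact a.2 ha))
    rw [extend_dotProduct_self hinj, extend_dotProduct_mulVec hinj, hyB] at h
    exact le_of_mul_le_mul_right h (dotProduct_self_pos hy)
  refine ⟨fun j hj => ⟨hupper _, ?_, hupper _⟩, ?_, hupper _, fun hM => ⟨?_, hupper _⟩⟩
  · exact (hint ⟨j + 1, hj⟩).1
  · nlinarith [mul_nonneg (le_min (c.piLow_nonneg i) (c.piHigh_nonneg i)) (hpos ⟨0, hn⟩).le]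
  · nlinarith [mul_le_mul_of_nonneg_right (le_min hM.1 hM.2) (hpos ⟨0, hn⟩).le, hpos ⟨0, hn⟩]


end
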